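/- The path graph P₅ is, up to isomorphism, the unique connected graph on 5 vertices having at least 4 maximal independent sets of which at least one contains at least 3 vertices. -/

import Mathlib

open Finset
open scoped Classical

section Framework

variable {V : Type*} {ι : Type*}

/-- An independent set of a simple graph, given as a `Finset` of vertices. -/
def IsIndepSet' (G : SimpleGraph V) (S : Finset V) : Prop :=
  ∀ i ∈ S, ∀ j ∈ S, ¬ G.Adj i j

/-- Total weight of a finite set of vertices. -/
noncomputable def wt (Δ : V → ℝ) (S : Finset V) : ℝ := ∑ v ∈ S, Δ v

/-- `S` is a maximum-weight independent set of `G` with weights `Δ`. -/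
def IsMWIS (G : SimpleGraph V) (Δ : V → ℝ) (S : Finset V) : Prop :=
  IsIndepSet' G S ∧ ∀ T : Finset V, IsIndepSet' G T → wt Δ T ≤ wt Δ S

/-- Indicator vector recording which ports are contained in `S`. -/
noncomputable def portInd (ports : ι → V) (S : Finset V) : ι → Bool :=
  fun i => if ports i ∈ S then true else false

/-- The weighted graph `G` with designated `ports` realizes the language `L`:
the map from maximum-weight independent sets to port indicator vectors is a
bijection onto `L`. -/
def Realizes (G : SimpleGraph V) (Δ : V → ℝ) (ports : ι → V)
    (L : Set (ι → Bool)) : Prop :=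
  (∀ S, IsMWIS G Δ S → portInd ports S ∈ L) ∧
  (∀ x ∈ L, ∃ S, IsMWIS G Δ S ∧ portInd ports S = x) ∧
  (∀ S T, IsMWIS G Δ S → IsMWIS G Δ T →
    portInd ports S = portInd ports T → S = T)

/-- A maximal independent set: no vertex can be added while staying independent. -/
def IsMaxlIndep (G : SimpleGraph V) (S : Finset V) : Prop :=
  IsIndepSet' G S ∧ ∀ v ∉ S, ¬ IsIndepSet' G (insert v S)

end Framework

theorem maxl_iff {V : Type*} (G : SimpleGraph V) (S : Finset V) :
    IsMaxlIndep G S ↔ (∀ i ∈ S, ∀ j ∈ S, ¬ G.Adj i j) ∧ ∀ v, v ∉ S → ∃ w ∈ S, G.Adj v w := by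
  unfold IsMaxlIndep IsIndepSet'
  refine and_congr_right fun h => forall_congr' fun v => forall_congr' fun hv => ?_
  constructor
  · intro h1
    by_contra! h2
    apply h1
    intro i hi j hj hij
    rw [Finset.mem_insert] at hi hj
    rcases hi with rfl | hi <;> rcases hj with rfl | hj
    · exact G.irrefl hij
    · exact h2 j hj hij
    · exact h2 i hi hij.symm
    · exact h i hi j hj hij
  · rintro ⟨w, hw, hvw⟩ h2
    exact h2 v (Finset.mem_insert_self _ _) w (Finset.mem_insert_of_mem hw) hvw

theorem maxl_map {V W : Type*} (G : SimpleGraph V) (H : SimpleGraph W) (f : G ≃g H)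
    (S : Finset V) (h : IsMaxlIndep G S) :
    IsMaxlIndep H (S.map f.toEquiv.toEmbedding) := by
  rw [maxl_iff] at h ⊢
  obtain ⟨h1, h2⟩ := h
  constructor
  · intro i hi j hj hij
    rw [Finset.mem_map] at hi hj
    obtain ⟨a, ha, rfl⟩ := hi
    obtain ⟨b, hb, rfl⟩ := hj
    exact h1 a ha b hb (f.map_adj_iff.1 hij)
  · intro v hv
    obtain ⟨a, rfl⟩ := f.toEquiv.surjective v
    have ha : a ∉ S := fun ha => hv (Finset.mem_map_of_mem _ ha)
    obtain ⟨w, hw, haw⟩ := h2 a ha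
    exact ⟨_, Finset.mem_map_of_mem _ hw, f.map_adj_iff.2 haw⟩

theorem path_maxl (S : Finset (Fin 5))
    (hS : S = {0,2,4} ∨ S = {0,3} ∨ S = {1,4} ∨ S = {1,3}) :
    IsMaxlIndep (SimpleGraph.pathGraph 5) S := by
  rw [maxl_iff]
  simp only [SimpleGraph.pathGraph_adj]
  rcases hS with rfl | rfl | rfl | rfl <;> decide

theorem path5_back (G : SimpleGraph (Fin 5)) (f : SimpleGraph.pathGraph 5 ≃g G) :
    G.Connected ∧ 4 ≤ {S : Finset (Fin 5) | IsMaxlIndep G S}.ncard ∧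
      ∃ S : Finset (Fin 5), IsMaxlIndep G S ∧ 3 ≤ S.card := by
  refine ⟨f.connected_iff.1 (SimpleGraph.pathGraph_connected 4), ?_,
    _, maxl_map _ _ f _ (path_maxl {0,2,4} (by simp)), ?_⟩
  · let F : Finset (Finset (Fin 5)) := {{0,2,4},{0,3},{1,4},{1,3}}
    have hF : F.card = 4 := by decide
    have hi : Function.Injective (fun S : Finset (Fin 5) => S.map f.toEquiv.toEmbedding) :=
      Finset.map_injective _
    have : ((fun S : Finset (Fin 5) => S.map f.toEquiv.toEmbedding) '' (F : Set _)).ncard = 4 := by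
      rw [Set.ncard_image_of_injective _ hi, Set.ncard_coe_finset, hF]
    rw [← this]
    apply Set.ncard_le_ncard _ (Set.toFinite _)
    rintro _ ⟨S, hS, rfl⟩
    exact maxl_map _ _ f _ (path_maxl S (by simpa [F] using hS))
  · rw [Finset.card_map]; decide

theorem crossing {V : Type*} (G : SimpleGraph V) (hG : G.Connected) (A : Set V) (u v : V)
    (hu : u ∈ A) (hv : v ∉ A) : ∃ x ∈ A, ∃ y, y ∉ A ∧ G.Adj x y := by
  obtain ⟨p⟩ := hG.preconnected u v
  obtain ⟨d, -, h1, h2⟩ := p.exists_boundary_dart A hu hv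
  exact ⟨_, h1, _, h2, d.adj⟩

theorem mkIso (G : SimpleGraph (Fin 5)) (hG : G.Connected) (x y z d e : Fin 5)
    (hall : ∀ v, v = x ∨ v = y ∨ v = z ∨ v = d ∨ v = e)
    (hde : ¬ G.Adj d e) (hxy : ¬ G.Adj x y) (hxz : ¬ G.Adj x z) (hyz : ¬ G.Adj y z)
    (hxe : G.Adj x e) (hxd : ¬ G.Adj x d) (hyd : G.Adj y d) (hye : ¬ G.Adj y e) :
    Nonempty (G ≃g SimpleGraph.pathGraph 5) := by
  have hsur : Function.Surjective (![y, d, z, e, x] : Fin 5 → Fin 5) := by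
    intro v
    rcases hall v with h | h | h | h | h
    · exact ⟨4, h.symm⟩
    · exact ⟨0, h.symm⟩
    · exact ⟨2, h.symm⟩
    · exact ⟨1, h.symm⟩
    · exact ⟨3, h.symm⟩
  have hbij : Function.Bijective (![y, d, z, e, x] : Fin 5 → Fin 5) :=
    ⟨Finite.injective_iff_surjective.2 hsur, hsur⟩
  have hne : ∀ i j : Fin 5, i ≠ j → (![y, d, z, e, x] : Fin 5 → Fin 5) i ≠ ![y, d, z, e, x] j :=
    fun i j h h' => h (hbij.1 h')
  have n1 : y ≠ z := hne 0 2 (by decide)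
  have n2 : d ≠ z := hne 1 2 (by decide)
  have n3 : e ≠ z := hne 3 2 (by decide)
  have n4 : x ≠ z := hne 4 2 (by decide)
  have n5 : d ≠ e := hne 1 3 (by decide)
  have n6 : y ≠ e := hne 0 3 (by decide)
  have n7 : x ≠ d := hne 4 1 (by decide)
  have n8 : x ≠ y := hne 4 0 (by decide)
  have hzd : G.Adj z d := by
    by_contra hzd
    obtain ⟨a, ha, b, hb, hab⟩ := crossing G hG {y, d} d z (by simp) (by simp [n1.symm, n2.symm])
    simp only [Set.mem_insert_iff, Set.mem_singleton_iff, not_or] at ha hb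
    have := hab.symm
    rcases ha with rfl | rfl <;> rcases hall b with rfl | rfl | rfl | rfl | rfl <;> simp_all
  have hze : G.Adj z e := by
    by_contra hze
    obtain ⟨a, ha, b, hb, hab⟩ := crossing G hG {x, e} e z (by simp) (by simp [n4.symm, n3.symm])
    simp only [Set.mem_insert_iff, Set.mem_singleton_iff, not_or] at ha hb
    have := hab.symm
    rcases ha with rfl | rfl <;> rcases hall b with rfl | rfl | rfl | rfl | rfl <;> simp_all
  refine ⟨SimpleGraph.Iso.symm ⟨Equiv.ofBijective _ hbij, ?_⟩⟩
  intro i j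
  have s1 := hzd.symm
  have s2 := hze.symm
  have s3 := hxe.symm
  have s4 := hyd.symm
  have t1 := fun h => hde (G.adj_symm h)
  have t2 := fun h => hxy (G.adj_symm h)
  have t3 := fun h => hxz (G.adj_symm h)
  have t4 := fun h => hyz (G.adj_symm h)
  have t5 := fun h => hxd (G.adj_symm h)
  have t6 := fun h => hye (G.adj_symm h)
  rw [SimpleGraph.pathGraph_adj]
  fin_cases i <;> fin_cases j <;> simp_all

theorem path5_forw (G : SimpleGraph (Fin 5)) (hG : G.Connected)
    (h4 : 4 ≤ {S : Finset (Fin 5) | IsMaxlIndep G S}.ncard)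
    (h3 : ∃ S : Finset (Fin 5), IsMaxlIndep G S ∧ 3 ≤ S.card) :
    Nonempty (G ≃g SimpleGraph.pathGraph 5) := by
  obtain ⟨S, hS, hc⟩ := h3
  obtain ⟨T, hTS, hT⟩ := Finset.exists_subset_card_eq hc
  have hTi : ∀ i ∈ T, ∀ j ∈ T, ¬ G.Adj i j := fun i hi j hj => hS.1 i (hTS hi) j (hTS hj)
  have hcc : Tᶜ.card = 2 := by rw [Finset.card_compl, hT]; rfl
  obtain ⟨d, e, hde, hD⟩ := Finset.card_eq_two.1 hcc
  have hmem : ∀ v, v ∉ T ↔ v = d ∨ v = e := by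
    intro v; rw [← Finset.mem_compl, hD]; simp
  have key : ∀ M M' : Finset (Fin 5), IsMaxlIndep G M → IsMaxlIndep G M' → M ∩ {d, e} = M' ∩ {d, e} →
      M ⊆ M' := by
    intro M M' hM hM' h x hx
    rw [maxl_iff] at hM hM'
    by_contra hx'
    obtain ⟨w, hw, hxw⟩ := hM'.2 x hx'
    have hsub : ∀ v, v ∉ T → (v ∈ M ↔ v ∈ M') := by
      intro v hv
      have h0 : v ∈ ({d, e} : Finset (Fin 5)) := by simpa using (hmem v).1 hv
      have := congrArg (v ∈ ·) h
      simpa only [Finset.mem_inter, h0, and_true, eq_iff_iff] using this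
    by_cases hxT : x ∈ T
    · by_cases hwT : w ∈ T
      · exact hTi x hxT w hwT hxw
      · exact hM.1 x hx w ((hsub w hwT).2 hw) hxw
    · exact hx' ((hsub x hxT).1 hx)
  have hsurj : ∀ A : Finset (Fin 5), A ⊆ {d, e} → ∃ M, IsMaxlIndep G M ∧ M ∩ {d, e} = A := by
    have hi : Set.InjOn (fun M : Finset (Fin 5) => M ∩ {d, e}) {S | IsMaxlIndep G S} :=
      fun M hM M' hM' h => (key M M' hM hM' h).antisymm (key M' M hM' hM h.symm)
    have h1 := hi.ncard_image
    have hp : (({d, e} : Finset (Fin 5)).powerset : Set (Finset (Fin 5))).ncard = 4 := by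
      rw [Set.ncard_coe_finset, Finset.card_powerset, Finset.card_pair hde]
      rfl
    have h2 : (fun M : Finset (Fin 5) => M ∩ {d, e}) '' {S | IsMaxlIndep G S} =
        (({d, e} : Finset (Fin 5)).powerset : Set (Finset (Fin 5))) := by
      apply Set.eq_of_subset_of_ncard_le _ _ (Set.toFinite _)
      · rintro _ ⟨M, -, rfl⟩
        simp
      · rw [h1, hp]; exact h4
    intro A hA
    have : A ∈ (({d, e} : Finset (Fin 5)).powerset : Set (Finset (Fin 5))) :=
      Finset.mem_coe.2 (Finset.mem_powerset.2 hA)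
    rw [← h2] at this
    exact this
  have hnde : ¬ G.Adj d e := by
    obtain ⟨M, hM, h⟩ := hsurj {d, e} subset_rfl
    have := Finset.inter_eq_right.1 h
    exact hM.1 d (this (by simp)) e (this (by simp))
  have side : ∀ d' e', d' ≠ e' → ({d', e'} : Finset (Fin 5)) = {d, e} → ¬ G.Adj d' e' →
      ∃ x ∈ T, G.Adj x e' ∧ ¬ G.Adj x d' := by
    intro d' e' hne hs hn
    obtain ⟨M, hM, h⟩ := hsurj {d'} (by rw [← hs]; simp)
    rw [← hs] at h
    rw [maxl_iff] at hM
    have hd : d' ∈ M := by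
      have : d' ∈ M ∩ {d', e'} := by rw [h]; simp
      exact (Finset.mem_inter.1 this).1
    have he : e' ∉ M := by
      intro he
      have : e' ∈ M ∩ {d', e'} := by simp [he]
      rw [h, Finset.mem_singleton] at this
      exact hne this.symm
    obtain ⟨w, hw, hew⟩ := hM.2 e' he
    refine ⟨w, ?_, hew.symm, hM.1 w hw d' hd⟩
    by_contra hwT
    have h0 : w ∈ ({d', e'} : Finset (Fin 5)) := by rw [hs]; simpa using (hmem w).1 hwT
    simp only [Finset.mem_insert, Finset.mem_singleton] at h0
    rcases h0 with rfl | rfl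
    · exact hn hew.symm
    · exact he hw
  obtain ⟨x, hx, hxe, hxd⟩ := side d e hde rfl hnde
  obtain ⟨y, hy, hyd, hye⟩ := side e d hde.symm (Finset.pair_comm _ _) (fun h => hnde h.symm)
  have hxy : x ≠ y := by rintro rfl; exact hye hxe
  obtain ⟨z, hz⟩ : ∃ z, (T.erase x).erase y = {z} := by
    rw [← Finset.card_eq_one, Finset.card_erase_of_mem (by simp [hxy.symm, hy]),
      Finset.card_erase_of_mem hx, hT]
  have hzT : z ∈ T := by
    have : z ∈ (T.erase x).erase y := by rw [hz]; simp
    exact Finset.mem_of_mem_erase (Finset.mem_of_mem_erase this)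
  refine mkIso G hG x y z d e ?_ hnde (hTi _ hx _ hy) (hTi _ hx _ hzT) (hTi _ hy _ hzT) hxe hxd hyd hye
  intro v
  by_cases hv : v ∈ T
  · by_cases h1 : v = x
    · exact Or.inl h1
    by_cases h2 : v = y
    · exact Or.inr (Or.inl h2)
    have : v ∈ (T.erase x).erase y := by simp [h1, h2, hv]
    rw [hz, Finset.mem_singleton] at this
    exact Or.inr (Or.inr (Or.inl this))
  · exact Or.inr (Or.inr (Or.inr ((hmem v).1 hv)))

/-- The path graph `P₅` is, up to isomorphism, the unique connected
graph on 5 vertices having at least 4 maximal independent sets of which at least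
one contains at least 3 vertices. -/
theorem path5_unique (G : SimpleGraph (Fin 5)) :
    (G.Connected ∧ 4 ≤ {S : Finset (Fin 5) | IsMaxlIndep G S}.ncard ∧
      ∃ S : Finset (Fin 5), IsMaxlIndep G S ∧ 3 ≤ S.card) ↔
    Nonempty (G ≃g SimpleGraph.pathGraph 5) := by
  constructor
  · rintro ⟨h1, h2, h3⟩
    exact path5_forw G h1 h2 h3
  · rintro ⟨f⟩
    exact path5_back G f.symm
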